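/- Let m ≥ 1, let b₁, …, b_n be Hermitian matrices in M = Matrix (Fin m) (Fin m) ℂ, let τ(a) = trace(a)/m, let Ψ(a) = ((τ a).re, (τ(b₁a)).re, …, (τ(b_na)).re) ∈ ℝ^{n+1}, and let B = Ψ({a ∈ M : a is positive semidefinite and 1 − a is positive semidefinite}) be the spectral scale. If the set of extreme points of B is countable (Set.Countable (extremePoints ℝ B)), then the matrices b₁, …, b_n commute pairwise (bᵢ·bⱼ = bⱼ·bᵢ for all i, j). -/

import Mathlib

open ComplexOrder

/-- The map `Ψ(a) = (Re τ(a), Re τ(b₁a), …, Re τ(bₙa))`, where `τ(a) = trace(a)/m`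
is the normalized trace on `Matrix (Fin m) (Fin m) ℂ`. -/
noncomputable def spectralScaleMap {m n : ℕ} (b : Fin n → Matrix (Fin m) (Fin m) ℂ)
    (a : Matrix (Fin m) (Fin m) ℂ) : EuclideanSpace ℝ (Fin (n + 1)) :=
  (WithLp.equiv 2 (Fin (n + 1) → ℝ)).symm
    (Fin.cons ((a.trace / m).re) (fun j => (((b j * a).trace / m).re)))

open Matrix in
/-- A diagonal entry of a positive semidefinite matrix vanishes only along with its row. -/
theorem Matrix.PosSemidef.row_eq_zero {n : Type*} [Fintype n] [DecidableEq n]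
    {A : Matrix n n ℂ} (hA : A.PosSemidef) {i : n} (hi : A i i = 0) (j : n) : A i j = 0 := by
  have h := (hA.dotProduct_mulVec_zero_iff (Pi.single i 1)).1 (by simpa using hi)
  have hji : A j i = 0 := by simpa using congrFun h j
  rw [← hA.isHermitian.apply i j, hji, star_zero]

section DiagonalMaximizer

variable {n : Type*} [DecidableEq n]

/-- The diagonal projection onto the coordinates where `w` is positive. -/
noncomputable def posDiagonal (w : n → ℝ) : Matrix n n ℂ :=
  Matrix.diagonal fun i => if 0 < w i then 1 else 0

theorem posDiagonal_posSemidef (w : n → ℝ) : (posDiagonal w).PosSemidef := by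
  rw [posDiagonal, Matrix.posSemidef_diagonal_iff]
  intro i
  split_ifs <;> simp

theorem one_sub_posDiagonal_posSemidef (w : n → ℝ) : (1 - posDiagonal w).PosSemidef := by
  rw [posDiagonal, ← Matrix.diagonal_one, Matrix.diagonal_sub, Matrix.posSemidef_diagonal_iff]
  intro i
  split_ifs <;> simp

variable [Fintype n]

theorem re_trace_diagonal_mul (w : n → ℝ) (A : Matrix n n ℂ) :
    (Matrix.diagonal (fun i => (w i : ℂ)) * A).trace.re = ∑ i, w i * (A i i).re := by
  simp [Matrix.trace]

theorem eq_posDiagonal_of_diag_eq {w : n → ℝ} {A : Matrix n n ℂ}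
    (hA : A.PosSemidef) (hA1 : (1 - A).PosSemidef)
    (h : ∀ i, A i i = if 0 < w i then 1 else 0) : A = posDiagonal w := by
  ext i j
  by_cases hij : i = j
  · subst hij
    simp [posDiagonal, h]
  · rw [posDiagonal, Matrix.diagonal_apply_ne _ hij]
    by_cases hi : 0 < w i
    · have := hA1.row_eq_zero (i := i) (by simp [h, hi]) j
      simpa [Matrix.one_apply_ne hij] using this
    · exact hA.row_eq_zero (by simp [h, hi]) j

/-- If all `w i` are nonzero, then `posDiagonal w` is the unique maximizer of
`A ↦ Re tr (diagonal w * A)` on the matrices `0 ≤ A ≤ 1`. -/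
theorem re_trace_diagonal_mul_lt {w : n → ℝ} (hw : ∀ i, w i ≠ 0) {A : Matrix n n ℂ}
    (hA : A.PosSemidef) (hA1 : (1 - A).PosSemidef) (hne : A ≠ posDiagonal w) :
    (Matrix.diagonal (fun i => (w i : ℂ)) * A).trace.re <
      (Matrix.diagonal (fun i => (w i : ℂ)) * posDiagonal w).trace.re := by
  rw [re_trace_diagonal_mul, re_trace_diagonal_mul]
  have h0 : ∀ i, 0 ≤ (A i i).re := fun i => (Complex.le_def.1 hA.diag_nonneg).1
  have him : ∀ i, (A i i).im = 0 := fun i =>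
    ((Complex.le_def.1 (hA.diag_nonneg (i := i))).2).symm
  have h1 : ∀ i, (A i i).re ≤ 1 := fun i => by
    have := (Complex.le_def.1 (hA1.diag_nonneg (i := i))).1
    simpa using this
  have hle : ∀ i, w i * (A i i).re ≤ w i * (posDiagonal w i i).re := fun i => by
    rw [posDiagonal, Matrix.diagonal_apply_eq]
    split_ifs with hi
    · simpa using mul_le_mul_of_nonneg_left (h1 i) hi.le
    · simpa using mul_nonpos_of_nonpos_of_nonneg (not_lt.1 hi) (h0 i)
  refine (Finset.sum_le_sum fun i _ => hle i).lt_of_ne fun heq => hne ?_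
  rw [Finset.sum_eq_sum_iff_of_le fun i _ => hle i] at heq
  refine eq_posDiagonal_of_diag_eq hA hA1 fun i => Complex.ext ?_ ?_
  · simpa [posDiagonal] using mul_left_cancel₀ (hw i) (heq i (Finset.mem_univ i))
  · rw [him]
    split_ifs <;> simp

end DiagonalMaximizer

/-- `p` is the only matrix `0 ≤ p ≤ 1` maximizing `Re tr ((c - x) a)` among all `0 ≤ a ≤ 1`. -/
def IsStrictTraceMaximizer {n : Type*} [Fintype n] [DecidableEq n] (c : Matrix n n ℂ) (x : ℝ)
    (p : Matrix n n ℂ) : Prop :=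
  p.PosSemidef ∧ (1 - p).PosSemidef ∧ ∀ a : Matrix n n ℂ, a.PosSemidef → (1 - a).PosSemidef →
    a ≠ p → (c * a).trace.re - x * a.trace.re < (c * p).trace.re - x * p.trace.re

open Matrix in
theorem isStrictTraceMaximizer_conj {n : Type*} [Fintype n] [DecidableEq n]
    {U : Matrix n n ℂ} (hU : Uᴴ * U = 1) (hU' : U * Uᴴ = 1) (μ : n → ℝ) {x : ℝ}
    (hx : ∀ i, μ i ≠ x) :
    IsStrictTraceMaximizer (U * diagonal (fun i => (μ i : ℂ)) * Uᴴ) x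
      (U * posDiagonal (fun i => μ i - x) * Uᴴ) := by
  have key : ∀ a : Matrix n n ℂ,
      ((U * diagonal (fun i => (μ i : ℂ)) * Uᴴ) * a).trace.re - x * a.trace.re =
        (diagonal (fun i => ((μ i - x : ℝ) : ℂ)) * (Uᴴ * a * U)).trace.re := fun a => by
    have h1 : diagonal (fun i => ((μ i - x : ℝ) : ℂ)) =
        diagonal (fun i => (μ i : ℂ)) - (x : ℂ) • (1 : Matrix n n ℂ) := by
      ext i j
      by_cases hij : i = j <;> simp [hij]
    have h2 : (Uᴴ * a * U).trace = a.trace := by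
      rw [Matrix.trace_mul_comm, ← Matrix.mul_assoc, hU', Matrix.one_mul]
    have h3 : ((U * diagonal (fun i => (μ i : ℂ)) * Uᴴ) * a).trace =
        (diagonal (fun i => (μ i : ℂ)) * (Uᴴ * a * U)).trace := by
      rw [Matrix.mul_assoc, Matrix.mul_assoc, Matrix.trace_mul_comm]
      simp only [Matrix.mul_assoc]
    rw [h1, h3, Matrix.sub_mul, Matrix.trace_sub, Matrix.smul_mul, Matrix.one_mul,
      Matrix.trace_smul, h2]
    simp
  have hback : ∀ d : Matrix n n ℂ, Uᴴ * (U * d * Uᴴ) * U = d := fun d => by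
    rw [Matrix.mul_assoc U, ← Matrix.mul_assoc, hU, Matrix.one_mul, Matrix.mul_assoc, hU,
      Matrix.mul_one]
  have hforth : ∀ d : Matrix n n ℂ, U * (Uᴴ * d * U) * Uᴴ = d := fun d => by
    rw [Matrix.mul_assoc Uᴴ, ← Matrix.mul_assoc, hU', Matrix.one_mul, Matrix.mul_assoc, hU',
      Matrix.mul_one]
  refine ⟨(posDiagonal_posSemidef _).mul_mul_conjTranspose_same U, ?_, fun a ha ha1 hne => ?_⟩
  · have := (one_sub_posDiagonal_posSemidef (fun i => μ i - x)).mul_mul_conjTranspose_same U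
    rwa [Matrix.mul_sub, Matrix.sub_mul, Matrix.mul_one, hU'] at this
  · rw [key, key, hback]
    refine re_trace_diagonal_mul_lt (fun i => sub_ne_zero.2 (hx i))
      (ha.conjTranspose_mul_mul_same U) ?_ fun h => hne ?_
    · have := ha1.conjTranspose_mul_mul_same U
      rwa [Matrix.mul_sub, Matrix.sub_mul, Matrix.mul_one, hU] at this
    · rw [← h, hforth]

/-- Just below `y` there is a point that separates the values of `μ` below `y` from the others. -/
theorem exists_separating_threshold {n : Type*} [Finite n] (μ : n → ℝ) (y : ℝ) :
    ∃ x, ∀ i, μ i ≠ x ∧ (x < μ i ↔ y ≤ μ i) := by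
  have h : ∀ᶠ x in nhdsWithin y (Set.Iio y), ∀ i, μ i ≠ x ∧ (x < μ i ↔ y ≤ μ i) := by
    rw [Filter.eventually_all]
    intro i
    rcases lt_or_ge (μ i) y with hi | hi
    · filter_upwards [Ioo_mem_nhdsLT hi] with x hx
      exact ⟨hx.1.ne, iff_of_false hx.1.not_gt hi.not_ge⟩
    · filter_upwards [self_mem_nhdsWithin] with x hx
      have : x < μ i := lt_of_lt_of_le hx hi
      exact ⟨this.ne', iff_of_true this hi⟩
  exact h.exists

open Matrix in
theorem commute_diagonal_iff {n R : Type*} [Fintype n] [DecidableEq n] [CommRing R] [IsDomain R]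
    {D : Matrix n n R} {v : n → R} :
    Commute D (diagonal v) ↔ ∀ i j, D i j ≠ 0 → v i = v j := by
  rw [Commute, SemiconjBy, ← Matrix.ext_iff]
  refine forall_congr' fun i => forall_congr' fun j => ?_
  rw [Matrix.mul_diagonal, Matrix.diagonal_mul, mul_comm, mul_eq_mul_right_iff]
  tauto

open Matrix in
/-- A Hermitian matrix has the same commutant as some finite family of matrices, each of which is a
strict maximizer of the trace functional of the matrix shifted by a scalar (namely its spectral
projections). -/
theorem exists_strictTraceMaximizers {n : Type*} [Fintype n] [DecidableEq n] {c : Matrix n n ℂ}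
    (hc : c.IsHermitian) :
    ∃ p : n → Matrix n n ℂ, (∀ k, ∃ x, IsStrictTraceMaximizer c x (p k)) ∧
      ∀ d, Commute d c ↔ ∀ k, Commute d (p k) := by
  obtain ⟨U, μ, hU, hU', rfl⟩ : ∃ (U : Matrix n n ℂ) (μ : n → ℝ), Uᴴ * U = 1 ∧ U * Uᴴ = 1 ∧
      c = U * diagonal (fun i => (μ i : ℂ)) * Uᴴ :=
    ⟨hc.eigenvectorUnitary, hc.eigenvalues, Unitary.coe_star_mul_self hc.eigenvectorUnitary,
      Unitary.coe_mul_star_self hc.eigenvectorUnitary, hc.spectral_theorem⟩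
  choose x hxμ using fun k => exists_separating_threshold μ (μ k)
  refine ⟨fun k => U * posDiagonal (fun i => μ i - x k) * Uᴴ,
    fun k => ⟨x k, isStrictTraceMaximizer_conj hU hU' μ fun i => (hxμ k i).1⟩, fun d => ?_⟩
  have hconj : ∀ e : Matrix n n ℂ, Commute d (U * e * Uᴴ) ↔ Commute (Uᴴ * d * U) e := fun e => by
    constructor <;> intro h
    · have h' : Uᴴ * (d * (U * e * Uᴴ)) * U = Uᴴ * ((U * e * Uᴴ) * d) * U := by rw [h.eq]
      calc Uᴴ * d * U * e = Uᴴ * d * U * e * (Uᴴ * U) := by rw [hU, Matrix.mul_one]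
        _ = Uᴴ * (d * (U * e * Uᴴ)) * U := by simp only [Matrix.mul_assoc]
        _ = (Uᴴ * U) * e * (Uᴴ * d * U) := by rw [h']; simp only [Matrix.mul_assoc]
        _ = e * (Uᴴ * d * U) := by rw [hU, Matrix.one_mul]
    · have h' : U * (Uᴴ * d * U * e) * Uᴴ = U * (e * (Uᴴ * d * U)) * Uᴴ := by rw [h.eq]
      calc d * (U * e * Uᴴ) = (U * Uᴴ) * d * (U * e * Uᴴ) := by rw [hU', Matrix.one_mul]
        _ = U * (Uᴴ * d * U * e) * Uᴴ := by simp only [Matrix.mul_assoc]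
        _ = U * e * Uᴴ * d * (U * Uᴴ) := by rw [h']; simp only [Matrix.mul_assoc]
        _ = U * e * Uᴴ * d := by rw [hU', Matrix.mul_one]
  simp only [hconj, posDiagonal, commute_diagonal_iff, sub_pos, (hxμ _ _).2]
  constructor
  · intro h k i j hij
    rw [Complex.ofReal_injective (h i j hij)]
  · intro h i j hij
    have h1 := h i i j hij
    have h2 := h j i j hij
    simp only [le_refl, if_true] at h1 h2
    have hij' : μ i ≤ μ j := by
      by_contra hlt
      simp [hlt] at h1
    have hji' : μ j ≤ μ i := by
      by_contra hlt
      simp [hlt] at h2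
    rw [le_antisymm hij' hji']

theorem spectralScaleMap_zero {m n : ℕ} (b : Fin n → Matrix (Fin m) (Fin m) ℂ)
    (a : Matrix (Fin m) (Fin m) ℂ) : spectralScaleMap b a 0 = a.trace.re / m := by
  simp [spectralScaleMap]

theorem spectralScaleMap_succ {m n : ℕ} (b : Fin n → Matrix (Fin m) (Fin m) ℂ)
    (a : Matrix (Fin m) (Fin m) ℂ) (j : Fin n) :
    spectralScaleMap b a j.succ = (b j * a).trace.re / m := by
  simp [spectralScaleMap]

/-- If `p` is the unique maximizer on `s` of a linear functional composed with `f`, then `f p` is an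
extreme point of the image of `s`. -/
theorem mem_extremePoints_image_of_unique_max {α E : Type*} [AddCommGroup E] [Module ℝ E]
    {f : α → E} {s : Set α} {p : α} (hp : p ∈ s) (g : E →ₗ[ℝ] ℝ)
    (hg : ∀ a ∈ s, a ≠ p → g (f a) < g (f p)) : f p ∈ Set.extremePoints ℝ (f '' s) := by
  have hle : ∀ a ∈ s, g (f a) ≤ g (f p) := fun a ha => by
    by_cases h : a = p
    · rw [h]
    · exact (hg a ha h).le
  rw [mem_extremePoints_iff_left]
  refine ⟨Set.mem_image_of_mem f hp, ?_⟩
  rintro _ ⟨a, ha, rfl⟩ _ ⟨a', ha', rfl⟩ ⟨r, t, hr, ht, hrt, heq⟩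
  by_contra hne
  have h1 := hg a ha fun h => hne (by rw [h])
  have h2 := hle a' ha'
  have h3 := congrArg g heq
  rw [map_add, map_smul, map_smul, smul_eq_mul, smul_eq_mul] at h3
  have h4 : r * g (f a) < r * g (f p) := mul_lt_mul_of_pos_left h1 hr
  have h5 : t * g (f a') ≤ t * g (f p) := mul_le_mul_of_nonneg_left h2 ht.le
  have h6 : r * g (f p) + t * g (f p) = g (f p) := by rw [← add_mul, hrt, one_mul]
  linarith

theorem stmt13 {m n : ℕ} (hm : 1 ≤ m) (b : Fin n → Matrix (Fin m) (Fin m) ℂ)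
    (hb : ∀ i, (b i).IsHermitian)
    (B : Set (EuclideanSpace ℝ (Fin (n + 1))))
    (hB : B = spectralScaleMap b ''
      {a : Matrix (Fin m) (Fin m) ℂ | a.PosSemidef ∧ (1 - a).PosSemidef})
    (h : (Set.extremePoints ℝ B).Countable) :
    ∀ i j, b i * b j = b j * b i := by
  intro i j
  set K := {a : Matrix (Fin m) (Fin m) ℂ | a.PosSemidef ∧ (1 - a).PosSemidef}
  set c : ℝ → Matrix (Fin m) (Fin m) ℂ := fun t => b i + (t : ℂ) • b j with hcdef
  have hm0 : (0 : ℝ) < m := by exact_mod_cast hm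
  let S : Set (Matrix (Fin m) (Fin m) ℂ) := {p | ∃ t x, IsStrictTraceMaximizer (c t) x p}
  let g : ℝ → ℝ → EuclideanSpace ℝ (Fin (n + 1)) →ₗ[ℝ] ℝ := fun t x =>
    EuclideanSpace.projₗ i.succ + t • EuclideanSpace.projₗ j.succ - x • EuclideanSpace.projₗ 0
  have hg : ∀ t x a, g t x (spectralScaleMap b a) =
      ((c t * a).trace.re - x * a.trace.re) / m := fun t x a => by
    have : g t x (spectralScaleMap b a) = spectralScaleMap b a i.succ +
        t * spectralScaleMap b a j.succ - x * spectralScaleMap b a 0 := rfl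
    rw [this, spectralScaleMap_zero, spectralScaleMap_succ, spectralScaleMap_succ]
    simp only [hcdef, Matrix.add_mul, Matrix.smul_mul, Matrix.trace_add, Matrix.trace_smul,
      Complex.add_re, smul_eq_mul, Complex.re_ofReal_mul]
    ring
  have hmax : ∀ {t x p}, IsStrictTraceMaximizer (c t) x p → ∀ a ∈ K, a ≠ p →
      g t x (spectralScaleMap b a) < g t x (spectralScaleMap b p) := fun hp a ha hne => by
    rw [hg, hg]
    exact div_lt_div_of_pos_right (hp.2.2 a ha.1 ha.2 hne) hm0
  have hS : S.Countable := by
    refine Set.MapsTo.countable_of_injOn (f := spectralScaleMap b) ?_ ?_ h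
    · rintro p ⟨t, x, hp⟩
      rw [hB]
      exact mem_extremePoints_image_of_unique_max ⟨hp.1, hp.2.1⟩ (g t x) (hmax hp)
    · rintro q ⟨t', x', hq⟩ p ⟨t, x, hp⟩ hqp
      by_contra hne
      have := hmax hp q ⟨hq.1, hq.2.1⟩ hne
      rw [hqp] at this
      exact lt_irrefl _ this
  have hherm : ∀ t, (c t).IsHermitian := fun t =>
    (hb i).add (by simp [Matrix.IsHermitian, Matrix.conjTranspose_smul, (hb j).eq])
  choose p hpmax hpcomm using fun t => exists_strictTraceMaximizers (hherm t)
  have : Countable S := hS.to_subtype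
  let F : ℝ → Fin m → S := fun t k => ⟨p t k, t, hpmax t k⟩
  obtain ⟨s, t, hF, hst⟩ : ∃ s t, F s = F t ∧ s ≠ t := by
    simpa [Function.Injective] using not_injective_uncountable_countable F
  have hpst : p s = p t := funext fun k => congrArg Subtype.val (congrFun hF k)
  have hcomm : Commute (c s) (c t) := by
    rw [hpcomm t, ← hpst, ← hpcomm s]
  have hd : ((s : ℂ) - t) • (b j * b i - b i * b j) = 0 := by
    have := sub_eq_zero.2 hcomm.eq
    simp only [hcdef, Matrix.add_mul, Matrix.mul_add, Matrix.smul_mul, Matrix.mul_smul] at this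
    rw [← this]
    module
  have hne : (s : ℂ) - t ≠ 0 := sub_ne_zero.2 fun h => hst (Complex.ofReal_injective h)
  exact (sub_eq_zero.1 ((smul_eq_zero.1 hd).resolve_left hne)).symm
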